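/- Fix a > 0 and 0 < b < 1, and let v(x) = exp(a |x|^b) for x ∈ ℤⁿ, where |·| is the Euclidean norm. Then: (a) v is a symmetric submultiplicative weight, i.e. v(x+y) ≤ v(x)v(y) and v(−x) = v(x); (b) v satisfies the GRS-condition: lim_{m→∞} v(mx)^{1/m} = 1 for every x ∈ ℤⁿ; (c) every f ∈ ℓ¹_v(ℤⁿ) is rapidly decreasing (sup_x |f(x)|(1+|x|)^s < ∞ for all s ≥ 0); and (d) if f ∈ ℓ¹_v(ℤⁿ) and λ(f) is invertible as a bounded operator on ℓ²(ℤⁿ), then there exists g ∈ ℓ¹_v(ℤⁿ) with f ♮ g = g ♮ f = δ_0. -/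

import Mathlib

open scoped BigOperators
open Filter Topology

noncomputable section

/-- The cocycle σ(l,m) = ∏_{1 ≤ j < k ≤ n} θ_{k,j}^{l_k m_j}. -/
def coc {n : ℕ} (θ : Fin n → Fin n → ℂ) (l m : Fin n → ℤ) : ℂ :=
  ∏ p ∈ Finset.univ.filter (fun p : Fin n × Fin n => p.1 < p.2), θ p.2 p.1 ^ (l p.2 * m p.1)

/-- Twisted convolution (f ♮ g)(x) = Σ_y f(y) g(x−y) σ(y, x−y). -/
def tconv {n : ℕ} (σ : (Fin n → ℤ) → (Fin n → ℤ) → ℂ) (f g : (Fin n → ℤ) → ℂ) :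
    (Fin n → ℤ) → ℂ :=
  fun x => ∑' y, f y * g (x - y) * σ y (x - y)

/-- δ_y, the indicator of {y}. -/
def delta {n : ℕ} (y : Fin n → ℤ) : (Fin n → ℤ) → ℂ := fun x => if x = y then 1 else 0

/-- ℓ²(ℤⁿ). -/
abbrev Ltwo (n : ℕ) := lp (fun _ : Fin n → ℤ => ℂ) 2

/-- The Euclidean norm of a point of ℤⁿ. -/
def enorm' {n : ℕ} (x : Fin n → ℤ) : ℝ :=
  Real.sqrt (∑ i : Fin n, ((x i : ℝ)) ^ 2)

namespace OffDiagonal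

open scoped ENNReal

/-- Bounded operators on `ℓ²(G)`. -/
abbrev Op (G : Type*) := lp (fun _ : G => ℂ) 2 →L[ℂ] lp (fun _ : G => ℂ) 2

/-- The standard basis vector of `ℓ²(G)` at `x`. -/
def basisVec {ι : Type*} [DecidableEq ι] (x : ι) : lp (fun _ : ι => ℂ) 2 := lp.single 2 x (1 : ℂ)

lemma norm_basisVec {ι : Type*} [DecidableEq ι] (x : ι) : ‖basisVec x‖ = 1 := by
  simp [basisVec, lp.norm_single]

lemma hasSum_entry_apply {ι : Type*} [DecidableEq ι] (A : Op ι)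
    (f : lp (fun _ : ι => ℂ) 2) (x : ι) :
    HasSum (fun y => f y * A (basisVec y) x) (A f x) := by
  have h := lp.hasSum_single (E := fun _ : ι => ℂ) (p := 2) (by simp) f
  have e : ∀ y, lp.single (E := fun _ : ι => ℂ) 2 y (f y) = f y • basisVec y := fun y => by
    rw [basisVec, ← lp.single_smul]; simp
  simp only [e] at h
  have h' := h.mapL ((lp.evalCLM ℂ (fun _ : ι => ℂ) 2 x).comp A)
  simp only [map_smul] at h'
  exact h'

lemma tsum_tsum_mul_mul_mul {ι : Type*} (d e p q : ι → ℝ≥0∞) :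
    ∑' u, ∑' z, d z * e u * (p z * q u) = (∑' z, d z * p z) * ∑' u, e u * q u := by
  rw [← ENNReal.tsum_mul_left]
  refine tsum_congr fun u => ?_
  rw [← ENNReal.tsum_mul_right]
  exact tsum_congr fun z => by ring

lemma tsum_rpow_mul_rpow_le {ι : Type*} {γ : ℝ} (h0 : 0 < γ) (h1 : γ < 1) (f g : ι → ℝ≥0∞) :
    ∑' x, f x ^ (1 - γ) * g x ^ γ ≤ (∑' x, f x) ^ (1 - γ) * (∑' x, g x) ^ γ := by
  rw [ENNReal.tsum_eq_iSup_sum]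
  refine iSup_le fun s => ?_
  have hpq : (1 - γ)⁻¹.HolderConjugate γ⁻¹ := by
    rw [Real.holderConjugate_iff]
    constructor
    · exact (one_lt_inv₀ (by linarith)).mpr (by linarith)
    · simp
  have h := ENNReal.inner_le_Lp_mul_Lq s (fun x => f x ^ (1 - γ)) (fun x => g x ^ γ) hpq
  have h1' : 1 - γ ≠ 0 := by linarith
  simp only [← ENNReal.rpow_mul, mul_inv_cancel₀ h1', mul_inv_cancel₀ h0.ne', ENNReal.rpow_one,
    one_div, inv_inv] at h
  refine h.trans ?_
  gcongr <;> exact ENNReal.sum_le_tsum s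

variable {G : Type*} [AddCommGroup G] [DecidableEq G]

/-- The supremum of the moduli of the matrix entries of `A` on the diagonal of index `z`. -/
def diagSup (A : Op G) (z : G) : ℝ≥0∞ := ⨆ x, ‖A (basisVec x) (x + z)‖ₑ

/-- The weighted sum of the suprema of `A` along its diagonals. -/
def diagNorm (w : G → ℝ≥0∞) (A : Op G) : ℝ≥0∞ := ∑' z, diagSup A z * w z

lemma enorm_entry_le_diagSup (A : Op G) (x y : G) :
    ‖A (basisVec x) y‖ₑ ≤ diagSup A (y - x) := by
  have h := le_iSup (fun u => ‖A (basisVec u) (u + (y - x))‖ₑ) x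
  simpa [diagSup] using h

lemma diagSup_le_enorm (A : Op G) (z : G) : diagSup A z ≤ ‖A‖ₑ := by
  refine iSup_le fun x => ?_
  have h : ‖A (basisVec x) (x + z)‖ ≤ ‖A‖ :=
    (lp.norm_apply_le_norm two_ne_zero _ _).trans
      ((A.le_opNorm _).trans_eq (by rw [norm_basisVec, mul_one]))
  exact enorm_le_iff_norm_le.mpr h

lemma diagSup_one_zero_le : diagSup (1 : Op G) 0 ≤ 1 :=
  iSup_le fun x => by simp [basisVec]

lemma diagSup_one_of_ne {z : G} (hz : z ≠ 0) : diagSup (1 : Op G) z = 0 := by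
  simp [diagSup, basisVec, hz]

lemma diagSup_add_le (A B : Op G) (z : G) : diagSup (A + B) z ≤ diagSup A z + diagSup B z := by
  refine iSup_le fun x => ?_
  refine (enorm_add_le _ _).trans (add_le_add ?_ ?_)
  · exact le_iSup (fun x => ‖A (basisVec x) (x + z)‖ₑ) x
  · exact le_iSup (fun x => ‖B (basisVec x) (x + z)‖ₑ) x

lemma diagSup_smul_le (c : ℂ) (A : Op G) (z : G) : diagSup (c • A) z ≤ ‖c‖ₑ * diagSup A z := by
  refine iSup_le fun x => ?_
  have h : (c • A) (basisVec x) (x + z) = c * A (basisVec x) (x + z) := rfl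
  rw [h, enorm_mul]
  gcongr
  exact le_iSup (fun x => ‖A (basisVec x) (x + z)‖ₑ) x

lemma diagSup_mul_le (A B : Op G) (z : G) :
    diagSup (A * B) z ≤ ∑' u, diagSup A (z - u) * diagSup B u := by
  refine iSup_le fun x => ?_
  have h := (hasSum_entry_apply A (B (basisVec x)) (x + z)).tsum_eq
  have h' : (A * B) (basisVec x) = A (B (basisVec x)) := rfl
  rw [h', ← h, ← (Equiv.addLeft x).tsum_eq]
  refine enorm_tsum_le_tsum_enorm.trans (ENNReal.tsum_le_tsum fun u => ?_)
  rw [enorm_mul, mul_comm]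
  gcongr
  · refine (enorm_entry_le_diagSup A _ _).trans_eq ?_
    congr 1; simp
  · refine (enorm_entry_le_diagSup B _ _).trans_eq ?_
    congr 1; simp

lemma diagSup_adjoint_le (A : Op G) (z : G) :
    diagSup (ContinuousLinearMap.adjoint A) z ≤ diagSup A (-z) := by
  refine iSup_le fun x => ?_
  have h : ContinuousLinearMap.adjoint A (basisVec x) (x + z)
      = starRingEnd ℂ (A (basisVec (x + z)) x) := by
    have h1 : inner ℂ (basisVec (x + z)) (ContinuousLinearMap.adjoint A (basisVec x))
        = inner ℂ (A (basisVec (x + z))) (basisVec x) :=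
      ContinuousLinearMap.adjoint_inner_right _ _ _
    simpa [basisVec, lp.inner_single_left, lp.inner_single_right] using h1
  rw [h]
  have h2 := enorm_entry_le_diagSup A (x + z) x
  simpa using h2

lemma diagSup_le_tsum {A : ℕ → Op G} {S : Op G} (h : HasSum A S) (z : G) :
    diagSup S z ≤ ∑' m, diagSup (A m) z := by
  refine iSup_le fun x => ?_
  have h1 := (h.mapL (ContinuousLinearMap.apply ℂ (lp (fun _ : G => ℂ) 2) (basisVec x))).mapL
    (lp.evalCLM ℂ (fun _ : G => ℂ) 2 (x + z))
  have h2 : S (basisVec x) (x + z) = ∑' m, A m (basisVec x) (x + z) := h1.tsum_eq.symm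
  rw [h2]
  exact enorm_tsum_le_tsum_enorm.trans (ENNReal.tsum_le_tsum fun m =>
    le_iSup (fun x => ‖A m (basisVec x) (x + z)‖ₑ) x)

lemma diagNorm_one_le (w : G → ℝ≥0∞) : diagNorm w (1 : Op G) ≤ w 0 := by
  rw [diagNorm, tsum_eq_single 0 fun z hz => by rw [diagSup_one_of_ne hz, zero_mul]]
  exact mul_le_of_le_one_left' diagSup_one_zero_le

lemma diagNorm_add_le (w : G → ℝ≥0∞) (A B : Op G) :
    diagNorm w (A + B) ≤ diagNorm w A + diagNorm w B := by
  rw [diagNorm, diagNorm, diagNorm, ← ENNReal.tsum_add]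
  refine ENNReal.tsum_le_tsum fun z => ?_
  rw [← add_mul]
  gcongr
  exact diagSup_add_le A B z

lemma diagNorm_smul_le (w : G → ℝ≥0∞) (c : ℂ) (A : Op G) :
    diagNorm w (c • A) ≤ ‖c‖ₑ * diagNorm w A := by
  rw [diagNorm, diagNorm, ← ENNReal.tsum_mul_left]
  refine ENNReal.tsum_le_tsum fun z => ?_
  rw [← mul_assoc]
  gcongr
  exact diagSup_smul_le c A z

lemma diagNorm_adjoint_le {w : G → ℝ≥0∞} (hw : ∀ x, w (-x) = w x) (A : Op G) :
    diagNorm w (ContinuousLinearMap.adjoint A) ≤ diagNorm w A := by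
  rw [diagNorm, diagNorm, ← (Equiv.neg G).tsum_eq]
  refine ENNReal.tsum_le_tsum fun z => ?_
  rw [Equiv.neg_apply, hw]
  gcongr
  simpa using diagSup_adjoint_le A (-z)

lemma diagNorm_le_tsum (w : G → ℝ≥0∞) {A : ℕ → Op G} {S : Op G} (h : HasSum A S) :
    diagNorm w S ≤ ∑' m, diagNorm w (A m) := by
  simp only [diagNorm]
  rw [ENNReal.tsum_comm]
  refine ENNReal.tsum_le_tsum fun z => ?_
  rw [ENNReal.tsum_mul_right]
  gcongr
  exact diagSup_le_tsum h z

lemma diagNorm_mul_le_tsum (w : G → ℝ≥0∞) (A B : Op G) :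
    diagNorm w (A * B) ≤ ∑' u, ∑' z, diagSup A z * diagSup B u * w (z + u) := by
  calc diagNorm w (A * B)
      ≤ ∑' z, ∑' u, diagSup A (z - u) * diagSup B u * w z := by
        refine ENNReal.tsum_le_tsum fun z => ?_
        rw [ENNReal.tsum_mul_right]
        gcongr
        exact diagSup_mul_le A B z
    _ = ∑' u, ∑' z, diagSup A z * diagSup B u * w (z + u) := by
        rw [ENNReal.tsum_comm]
        refine tsum_congr fun u => ?_
        rw [← (Equiv.addRight u).tsum_eq]
        simp

lemma diagNorm_mul_le {w : G → ℝ≥0∞} (hw : ∀ x y, w (x + y) ≤ w x * w y) (A B : Op G) :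
    diagNorm w (A * B) ≤ diagNorm w A * diagNorm w B := by
  refine (diagNorm_mul_le_tsum w A B).trans ?_
  rw [diagNorm, diagNorm, ← tsum_tsum_mul_mul_mul]
  gcongr
  exact hw _ _

lemma diagNorm_mul_self_le {w : G → ℝ≥0∞} {c : ℝ}
    (hw : ∀ x y, w (x + y) ≤ w x * w y ^ c + w x ^ c * w y) (A : Op G) :
    diagNorm w (A * A) ≤ 2 * (diagNorm w A * diagNorm (fun x => w x ^ c) A) := by
  refine (diagNorm_mul_le_tsum w A A).trans ?_
  calc ∑' u, ∑' z, diagSup A z * diagSup A u * w (z + u)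
      ≤ ∑' u, ∑' z, (diagSup A z * diagSup A u * (w z * w u ^ c)
          + diagSup A z * diagSup A u * (w z ^ c * w u)) := by
        gcongr with u z
        rw [← mul_add]
        gcongr
        exact hw _ _
    _ = 2 * (diagNorm w A * diagNorm (fun x => w x ^ c) A) := by
        simp_rw [ENNReal.tsum_add]
        rw [tsum_tsum_mul_mul_mul, tsum_tsum_mul_mul_mul (p := fun x => w x ^ c)]
        simp only [diagNorm]
        ring

lemma diagNorm_pow_ne_top {w : G → ℝ≥0∞} (hw : ∀ x y, w (x + y) ≤ w x * w y) (h0 : w 0 ≠ ∞)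
    {A : Op G} (hA : diagNorm w A ≠ ∞) (m : ℕ) : diagNorm w (A ^ m) ≠ ∞ := by
  induction m with
  | zero => simpa using ne_top_of_le_ne_top h0 (diagNorm_one_le w)
  | succ m ih =>
    rw [pow_succ]
    exact ne_top_of_le_ne_top (ENNReal.mul_ne_top ih hA) (diagNorm_mul_le hw _ _)

lemma diagNorm_sum_ne_top {w : G → ℝ≥0∞} {A : ℕ → Op G} (hA : ∀ m, diagNorm w (A m) ≠ ∞)
    (N : ℕ) : diagNorm w (∑ m ∈ Finset.range N, A m) ≠ ∞ := by
  induction N with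
  | zero => simp [diagNorm, diagSup]
  | succ N ih =>
    rw [Finset.sum_range_succ]
    exact ne_top_of_le_ne_top (ENNReal.add_ne_top.mpr ⟨ih, hA N⟩) (diagNorm_add_le w _ _)

lemma diagNorm_rpow_le {w : G → ℝ≥0∞} (hw0 : ∀ x, w x ≠ 0) (hwt : ∀ x, w x ≠ ∞)
    {γ : ℝ} (h0 : 0 < γ) (h1 : γ < 1 / 2) (A : Op G) :
    diagNorm (fun x => w x ^ (1 - 2 * γ)) A
      ≤ (∑' x, (w x)⁻¹) ^ γ * diagNorm w A ^ (1 - γ) * ‖A‖ₑ ^ γ := by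
  calc diagNorm (fun x => w x ^ (1 - 2 * γ)) A
      ≤ ∑' x, ‖A‖ₑ ^ γ * ((diagSup A x * w x) ^ (1 - γ) * (w x)⁻¹ ^ γ) := by
        refine ENNReal.tsum_le_tsum fun x => ?_
        have e1 : diagSup A x = diagSup A x ^ γ * diagSup A x ^ (1 - γ) := by
          rw [← ENNReal.rpow_add_of_nonneg _ _ h0.le (by linarith)]
          simp
        have e2 : w x ^ (1 - 2 * γ) = w x ^ (1 - γ) * (w x)⁻¹ ^ γ := by
          rw [← ENNReal.rpow_neg_one, ← ENNReal.rpow_mul, ← ENNReal.rpow_add _ _ (hw0 x) (hwt x)]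
          congr 1; ring
        calc diagSup A x * w x ^ (1 - 2 * γ)
            = diagSup A x ^ γ * (diagSup A x ^ (1 - γ) * w x ^ (1 - γ) * (w x)⁻¹ ^ γ) := by
              rw [e2]; nth_rewrite 1 [e1]; ring
          _ ≤ ‖A‖ₑ ^ γ * ((diagSup A x * w x) ^ (1 - γ) * (w x)⁻¹ ^ γ) := by
              rw [ENNReal.mul_rpow_of_nonneg _ _ (by linarith : 0 ≤ 1 - γ)]
              gcongr
              exact diagSup_le_enorm A x
    _ ≤ ‖A‖ₑ ^ γ * ((∑' x, diagSup A x * w x) ^ (1 - γ) * (∑' x, (w x)⁻¹) ^ γ) := by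
        rw [ENNReal.tsum_mul_left]
        gcongr
        exact tsum_rpow_mul_rpow_le h0 (by linarith) _ _
    _ = _ := by rw [diagNorm]; ring


/-- If the diagonal norm of `A` is finite and `‖A‖ < 1`, some power of `A` has diagonal norm
less than one. -/
lemma exists_diagNorm_pow_lt_one {w : G → ℝ≥0∞} (hw0 : ∀ x, w x ≠ 0) (hwt : ∀ x, w x ≠ ∞)
    {γ : ℝ} (h0 : 0 < γ) (h1 : γ < 1 / 2)
    (hw : ∀ x y, w (x + y) ≤ w x * w y ^ (1 - 2 * γ) + w x ^ (1 - 2 * γ) * w y)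
    (hsum : ∑' x, (w x)⁻¹ ≠ ∞) {A : Op G} (hA : diagNorm w A ≠ ∞) (hn : ‖A‖ₑ < 1) :
    ∃ k : ℕ, diagNorm w (A ^ 2 ^ k) < 1 := by
  by_contra! hcon
  set L : ℝ≥0∞ := max 1 (2 * (∑' x, (w x)⁻¹) ^ γ) with hL
  have hL1 : 1 ≤ L := le_max_left _ _
  have hLt : L ≠ ∞ := by
    refine (max_lt ENNReal.one_lt_top ?_).ne
    exact ENNReal.mul_lt_top (by simp) (ENNReal.rpow_lt_top_of_nonneg h0.le hsum)
  set r : ℝ≥0∞ := ‖A‖ₑ ^ (γ / 2) with hr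
  have hr1 : r < 1 := ENNReal.rpow_lt_one hn (by linarith)
  have hstep : ∀ k : ℕ, diagNorm w (A ^ 2 ^ (k + 1))
      ≤ L * diagNorm w (A ^ 2 ^ k) ^ 2 * r ^ (2 * 2 ^ k) := by
    intro k
    set u := diagNorm w (A ^ 2 ^ k)
    have hnorm : ‖A ^ 2 ^ k‖ₑ ^ γ ≤ r ^ (2 * 2 ^ k) := by
      have h2 : ‖A ^ 2 ^ k‖ₑ ≤ ‖A‖ₑ ^ 2 ^ k := by
        rw [enorm_eq_nnnorm, enorm_eq_nnnorm]
        exact_mod_cast nnnorm_pow_le' A (by positivity)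
      calc ‖A ^ 2 ^ k‖ₑ ^ γ ≤ (‖A‖ₑ ^ 2 ^ k) ^ γ := by gcongr
        _ = r ^ (2 * 2 ^ k) := by
          rw [hr, ← ENNReal.rpow_natCast, ← ENNReal.rpow_natCast, ← ENNReal.rpow_mul,
            ← ENNReal.rpow_mul]
          congr 1; push_cast; ring
    calc diagNorm w (A ^ 2 ^ (k + 1)) = diagNorm w (A ^ 2 ^ k * A ^ 2 ^ k) := by
          rw [← pow_add, pow_succ, mul_two]
      _ ≤ 2 * (u * diagNorm (fun x => w x ^ (1 - 2 * γ)) (A ^ 2 ^ k)) :=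
          diagNorm_mul_self_le hw _
      _ ≤ 2 * (u * ((∑' x, (w x)⁻¹) ^ γ * u ^ (1 - γ) * ‖A ^ 2 ^ k‖ₑ ^ γ)) := by
          gcongr
          exact diagNorm_rpow_le hw0 hwt h0 h1 _
      _ ≤ 2 * (u * ((∑' x, (w x)⁻¹) ^ γ * u * r ^ (2 * 2 ^ k))) := by
          gcongr
          calc u ^ (1 - γ) ≤ u ^ (1 : ℝ) :=
                ENNReal.rpow_le_rpow_of_exponent_le (hcon k) (by linarith)
            _ = u := ENNReal.rpow_one u
      _ = 2 * (∑' x, (w x)⁻¹) ^ γ * u ^ 2 * r ^ (2 * 2 ^ k) := by ring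
      _ ≤ _ := by gcongr; exact le_max_right _ _
  have hbound : ∀ k : ℕ, L * diagNorm w (A ^ 2 ^ k) ≤ (L * diagNorm w A * r ^ k) ^ 2 ^ k := by
    intro k
    induction k with
    | zero => simp
    | succ k ih =>
      calc L * diagNorm w (A ^ 2 ^ (k + 1))
          ≤ L * (L * diagNorm w (A ^ 2 ^ k) ^ 2 * r ^ (2 * 2 ^ k)) := by
            gcongr; exact hstep k
        _ = (L * diagNorm w (A ^ 2 ^ k)) ^ 2 * r ^ (2 * 2 ^ k) := by ring
        _ ≤ ((L * diagNorm w A * r ^ k) ^ 2 ^ k) ^ 2 * r ^ (2 * 2 ^ k) := by gcongr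
        _ = (L * diagNorm w A * r ^ (k + 1)) ^ 2 ^ (k + 1) := by
            simp only [pow_succ, pow_mul, mul_pow]; ring
  have hlim : Tendsto (fun k : ℕ => L * diagNorm w A * r ^ k) atTop (𝓝 0) := by
    have := ENNReal.Tendsto.const_mul (ENNReal.tendsto_pow_atTop_nhds_zero_of_lt_one hr1)
      (a := L * diagNorm w A) (Or.inr (ENNReal.mul_ne_top hLt hA))
    simpa using this
  obtain ⟨k, hk⟩ := (hlim.eventually (gt_mem_nhds one_pos)).exists
  have h3 : L * diagNorm w (A ^ 2 ^ k) < 1 :=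
    (hbound k).trans_lt (pow_lt_one₀ (by simp) hk (by positivity))
  have h4 : 1 ≤ L * diagNorm w (A ^ 2 ^ k) := one_le_mul hL1 (hcon k)
  exact absurd h3 h4.not_gt

lemma diagNorm_neumann_ne_top {w : G → ℝ≥0∞} (hmul : ∀ x y, w (x + y) ≤ w x * w y)
    (h0 : w 0 ≠ ∞) {A : Op G} (hA : diagNorm w A < 1) (hn : ‖A‖ < 1) :
    diagNorm w (∑' m, A ^ m) ≠ ∞ := by
  have hs : HasSum (fun m => A ^ m) (∑' m, A ^ m) :=
    (_root_.summable_geometric_of_norm_lt_one hn).hasSum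
  refine ne_top_of_le_ne_top ?_ (diagNorm_le_tsum w hs)
  have hle : ∀ m : ℕ, diagNorm w (A ^ m) ≤ w 0 * diagNorm w A ^ m := by
    intro m
    induction m with
    | zero => simpa using diagNorm_one_le w
    | succ m ih =>
      rw [pow_succ, pow_succ, ← mul_assoc]
      refine (diagNorm_mul_le hmul _ _).trans ?_
      gcongr
  refine ne_top_of_le_ne_top ?_ (ENNReal.tsum_le_tsum hle)
  rw [ENNReal.tsum_mul_left, ENNReal.tsum_geometric]
  exact ENNReal.mul_ne_top h0 (by simpa [tsub_eq_zero_iff_le] using hA)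

lemma diagNorm_inverse_one_sub_ne_top {w : G → ℝ≥0∞} (hw0 : ∀ x, w x ≠ 0) (hwt : ∀ x, w x ≠ ∞)
    {γ : ℝ} (h0 : 0 < γ) (h1 : γ < 1 / 2) (hmul : ∀ x y, w (x + y) ≤ w x * w y)
    (hw : ∀ x y, w (x + y) ≤ w x * w y ^ (1 - 2 * γ) + w x ^ (1 - 2 * γ) * w y)
    (hsum : ∑' x, (w x)⁻¹ ≠ ∞) {A : Op G} (hA : diagNorm w A ≠ ∞) (hn : ‖A‖ < 1) :
    ∃ B : Op G, B * (1 - A) = 1 ∧ diagNorm w B ≠ ∞ := by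
  have hn' : ‖A‖ₑ < 1 := by
    rw [enorm_eq_nnnorm]
    exact_mod_cast hn
  obtain ⟨k, hk⟩ := exists_diagNorm_pow_lt_one hw0 hwt h0 h1 hw hsum hA hn'
  have hP : ‖A ^ 2 ^ k‖ < 1 :=
    (norm_pow_le' A (by positivity)).trans_lt (pow_lt_one₀ (norm_nonneg _) hn (by positivity))
  refine ⟨(∑' m, (A ^ 2 ^ k) ^ m) * ∑ i ∈ Finset.range (2 ^ k), A ^ i, ?_, ?_⟩
  · rw [mul_assoc, geom_sum_mul_neg, geom_series_mul_neg _ hP]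
  · exact ne_top_of_le_ne_top (ENNReal.mul_ne_top
      (diagNorm_neumann_ne_top hmul (hwt 0) hk hP)
      (diagNorm_sum_ne_top (diagNorm_pow_ne_top hmul (hwt 0) hA) _)) (diagNorm_mul_le hmul _ _)

lemma exists_norm_one_sub_smul_adjoint_mul_lt_one {E : Type*} [NormedAddCommGroup E]
    [InnerProductSpace ℂ E] [CompleteSpace E] (T : E ≃L[ℂ] E) :
    ∃ κ : ℂ, ‖1 - κ • (ContinuousLinearMap.adjoint (T : E →L[ℂ] E) * (T : E →L[ℂ] E))‖ < 1 := by
  set S : E →L[ℂ] E := ContinuousLinearMap.adjoint (T : E →L[ℂ] E) * (T : E →L[ℂ] E)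
  set N : ℝ := ‖(T.symm : E →L[ℂ] E)‖ + 1 with hN
  set Q : ℝ := ‖S‖ + 1 with hQ
  have hN0 : 0 < N := by positivity
  have hQ0 : 0 < Q := by positivity
  set κ : ℝ := (N ^ 2 * Q ^ 2)⁻¹ with hκ
  have hκ0 : 0 < κ := by positivity
  set c : ℝ := κ / N ^ 2 with hc
  have hc0 : 0 < c := by positivity
  have hκQ : κ ^ 2 * Q ^ 2 = c := by rw [hc, hκ]; field_simp
  have hpt : ∀ x, ‖(1 - (κ : ℂ) • S) x‖ ^ 2 ≤ (1 - c) * ‖x‖ ^ 2 := by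
    intro x
    have e1 : (1 - (κ : ℂ) • S) x = x - (κ : ℂ) • S x := rfl
    have e2 : inner ℂ x (S x) = ((‖T x‖ ^ 2 : ℝ) : ℂ) := by
      have : S x = ContinuousLinearMap.adjoint (T : E →L[ℂ] E) (T x) := rfl
      rw [this, ContinuousLinearMap.adjoint_inner_right]
      simp
    have e3 : ‖x‖ ≤ N * ‖T x‖ := by
      have h := (T.symm : E →L[ℂ] E).le_opNorm (T x)
      simp only [ContinuousLinearEquiv.coe_coe, ContinuousLinearEquiv.symm_apply_apply] at h
      refine h.trans ?_
      gcongr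
      linarith
    have e4 : ‖S x‖ ≤ Q * ‖x‖ := by
      refine (S.le_opNorm x).trans ?_
      gcongr
      linarith
    have e5 : ‖x‖ ^ 2 / N ^ 2 ≤ ‖T x‖ ^ 2 := by
      rw [div_le_iff₀ (by positivity)]
      calc ‖x‖ ^ 2 ≤ (N * ‖T x‖) ^ 2 := by gcongr
        _ = _ := by ring
    have e6 : (κ * ‖S x‖) ^ 2 ≤ c * ‖x‖ ^ 2 := by
      calc (κ * ‖S x‖) ^ 2 ≤ (κ * (Q * ‖x‖)) ^ 2 := by gcongr
        _ = κ ^ 2 * Q ^ 2 * ‖x‖ ^ 2 := by ring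
        _ = _ := by rw [hκQ]
    have e7 : κ * (‖x‖ ^ 2 / N ^ 2) = c * ‖x‖ ^ 2 := by rw [hc]; ring
    rw [e1, norm_sub_sq (𝕜 := ℂ), inner_smul_right, e2, norm_smul]
    have e8 : RCLike.re ((κ : ℂ) * ((‖T x‖ ^ 2 : ℝ) : ℂ)) = κ * ‖T x‖ ^ 2 := by
      rw [← Complex.ofReal_mul]; exact Complex.ofReal_re _
    rw [e8]
    have e9 : ‖(κ : ℂ)‖ = κ := by simp [abs_of_pos hκ0]
    rw [e9]
    have := mul_le_mul_of_nonneg_left e5 hκ0.le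
    nlinarith
  refine ⟨κ, ?_⟩
  have hle : ‖1 - (κ : ℂ) • S‖ ≤ Real.sqrt (1 - c) := by
    refine ContinuousLinearMap.opNorm_le_bound _ (Real.sqrt_nonneg _) fun x => ?_
    rw [← Real.sqrt_sq (norm_nonneg x), ← Real.sqrt_mul' _ (sq_nonneg _)]
    exact Real.le_sqrt_of_sq_le (hpt x)
  exact hle.trans_lt ((Real.sqrt_lt' one_pos).mpr (by linarith))

/-- Operators with finite diagonal norm form an inverse-closed class. -/
theorem diagNorm_symm_ne_top {w : G → ℝ≥0∞} (hw0 : ∀ x, w x ≠ 0) (hwt : ∀ x, w x ≠ ∞)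
    {γ : ℝ} (h0 : 0 < γ) (h1 : γ < 1 / 2) (hneg : ∀ x, w (-x) = w x)
    (hmul : ∀ x y, w (x + y) ≤ w x * w y)
    (hw : ∀ x y, w (x + y) ≤ w x * w y ^ (1 - 2 * γ) + w x ^ (1 - 2 * γ) * w y)
    (hsum : ∑' x, (w x)⁻¹ ≠ ∞)
    (T : lp (fun _ : G => ℂ) 2 ≃L[ℂ] lp (fun _ : G => ℂ) 2)
    (hT : diagNorm w (T : Op G) ≠ ∞) :
    diagNorm w (T.symm : Op G) ≠ ∞ := by
  obtain ⟨κ, hκ⟩ := exists_norm_one_sub_smul_adjoint_mul_lt_one T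
  set R : Op G := ContinuousLinearMap.adjoint (T : Op G)
  have hRt : diagNorm w R ≠ ∞ := ne_top_of_le_ne_top hT (diagNorm_adjoint_le hneg _)
  have hH : diagNorm w (1 - κ • (R * (T : Op G))) ≠ ∞ := by
    rw [sub_eq_add_neg, ← neg_smul]
    refine ne_top_of_le_ne_top (ENNReal.add_ne_top.mpr
      ⟨ne_top_of_le_ne_top (hwt 0) (diagNorm_one_le w), ?_⟩) (diagNorm_add_le w _ _)
    refine ne_top_of_le_ne_top (ENNReal.mul_ne_top (by simp) ?_) (diagNorm_smul_le w _ _)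
    exact ne_top_of_le_ne_top (ENNReal.mul_ne_top hRt hT) (diagNorm_mul_le hmul _ _)
  obtain ⟨B, hB, hBt⟩ := diagNorm_inverse_one_sub_ne_top hw0 hwt h0 h1 hmul hw hsum hH hκ
  rw [sub_sub_cancel] at hB
  have hleft : (κ • (B * R)) * (T : Op G) = 1 := by
    rw [smul_mul_assoc, mul_assoc, ← mul_smul_comm, hB]
  have hsymm : (T.symm : Op G) = κ • (B * R) := by
    ext1 x
    have h := DFunLike.congr_fun hleft (T.symm x)
    have h' : (κ • (B * R)) (T (T.symm x)) = T.symm x := h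
    rw [T.apply_symm_apply] at h'
    exact h'.symm
  rw [hsymm]
  refine ne_top_of_le_ne_top (ENNReal.mul_ne_top (by simp) ?_) (diagNorm_smul_le w _ _)
  exact ne_top_of_le_ne_top (ENNReal.mul_ne_top hBt hRt) (diagNorm_mul_le hmul _ _)

end OffDiagonal

section EuclideanNorm

variable {n : ℕ}

lemma enorm'_eq_norm (x : Fin n → ℤ) :
    enorm' x = ‖(WithLp.toLp 2 (fun i => (x i : ℝ)) : EuclideanSpace ℝ (Fin n))‖ := by
  simp [enorm', EuclideanSpace.norm_eq]

lemma enorm'_nonneg (x : Fin n → ℤ) : 0 ≤ enorm' x := Real.sqrt_nonneg _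

lemma enorm'_neg (x : Fin n → ℤ) : enorm' (-x) = enorm' x := by simp [enorm']

lemma enorm'_add_le (x y : Fin n → ℤ) : enorm' (x + y) ≤ enorm' x + enorm' y := by
  simp only [enorm'_eq_norm]
  refine le_trans (le_of_eq ?_) (norm_add_le _ _)
  congr 1
  ext i
  simp

lemma enorm'_nsmul (m : ℕ) (x : Fin n → ℤ) : enorm' (m • x) = m * enorm' x := by
  rw [enorm', enorm']
  simp only [Pi.smul_apply, nsmul_eq_mul, Int.cast_mul, Int.cast_natCast, mul_pow]
  rw [← Finset.mul_sum, Real.sqrt_mul (by positivity), Real.sqrt_sq (by positivity)]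

lemma abs_apply_le_enorm' (x : Fin n → ℤ) (i : Fin n) : |(x i : ℝ)| ≤ enorm' x := by
  rw [enorm']
  refine Real.abs_le_sqrt ?_
  exact Finset.single_le_sum (f := fun i => (x i : ℝ) ^ 2) (fun j _ => sq_nonneg _)
    (Finset.mem_univ i)

end EuclideanNorm

section ScalarEstimates

/-- The increment `(s + t) ^ b - s ^ b` of a concave power is at most its value at `s = t`. -/
lemma add_rpow_le_of_le {b s t : ℝ} (hb0 : 0 < b) (hb1 : b < 1) (ht : 0 ≤ t) (hts : t ≤ s) :
    (s + t) ^ b ≤ s ^ b + (2 ^ b - 1) * t ^ b := by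
  rcases ht.eq_or_lt with rfl | ht
  · simp [Real.zero_rpow hb0.ne']
  have hs : 0 < s := ht.trans_le hts
  have hc := Real.concaveOn_rpow hb0.le hb1.le
  have hl0 : 0 ≤ t / s := by positivity
  have hl1 : 0 ≤ 1 - t / s := by
    rw [sub_nonneg, div_le_one hs]; exact hts
  have h1 := hc.2 (x := t) (y := s + t) (Set.mem_Ici.mpr ht.le)
    (Set.mem_Ici.mpr (by positivity)) hl0 hl1 (by ring)
  have h2 := hc.2 (x := t) (y := s + t) (Set.mem_Ici.mpr ht.le)
    (Set.mem_Ici.mpr (by positivity)) hl1 hl0 (by ring)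
  simp only [smul_eq_mul] at h1 h2
  have e1 : t / s * t + (1 - t / s) * (s + t) = s := by field_simp; ring
  have e2 : (1 - t / s) * t + t / s * (s + t) = 2 * t := by field_simp; ring
  rw [e1] at h1
  rw [e2, Real.mul_rpow (by norm_num) ht.le] at h2
  linarith

lemma exists_one_add_rpow_le_mul_exp {a b : ℝ} (ha : 0 < a) (hb0 : 0 < b) (hb1 : b < 1) {s : ℝ}
    (hs : 0 ≤ s) :
    ∃ C : ℝ, 0 < C ∧ ∀ t : ℝ, 0 ≤ t → (1 + t) ^ s ≤ C * Real.exp (a * t ^ b) := by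
  set q : ℝ := 2 * s / b with hq
  refine ⟨Real.exp (a + q ^ 2 / (4 * a)), Real.exp_pos _, fun t ht => ?_⟩
  have h1t : 0 < 1 + t := by linarith
  set u : ℝ := (1 + t) ^ (b / 2) with hu
  have hlog : Real.log (1 + t) ≤ u / (b / 2) := Real.log_le_rpow_div h1t.le (by linarith)
  have hu2 : u ^ 2 = (1 + t) ^ b := by
    rw [hu, ← Real.rpow_natCast, ← Real.rpow_mul h1t.le]
    congr 1; push_cast; ring
  have hle : (1 + t) ^ b ≤ 1 + t ^ b := by
    simpa using Real.rpow_add_le_add_rpow zero_le_one ht hb0.le hb1.le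
  have hquad : q * u ≤ a * u ^ 2 + q ^ 2 / (4 * a) := by
    have : a * u ^ 2 + q ^ 2 / (4 * a) - q * u = (2 * a * u - q) ^ 2 / (4 * a) := by
      field_simp; ring
    have h0 : 0 ≤ (2 * a * u - q) ^ 2 / (4 * a) := by positivity
    linarith
  rw [← Real.exp_add, Real.rpow_def_of_pos h1t]
  refine Real.exp_le_exp.mpr ?_
  calc Real.log (1 + t) * s ≤ u / (b / 2) * s := by gcongr
    _ = q * u := by rw [hq]; field_simp
    _ ≤ a * u ^ 2 + q ^ 2 / (4 * a) := hquad
    _ ≤ a * (1 + t ^ b) + q ^ 2 / (4 * a) := by rw [hu2]; gcongr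
    _ = _ := by ring

lemma summable_one_add_abs_int_pow_two_inv : Summable fun k : ℤ => ((1 + |(k : ℝ)|) ^ 2)⁻¹ := by
  have h : Summable fun k : ℕ => ((1 + (k : ℝ)) ^ 2)⁻¹ := by
    have := (summable_nat_add_iff 1).mpr (Real.summable_nat_pow_inv.mpr one_lt_two)
    simpa [add_comm] using this
  apply Summable.of_nat_of_neg <;> simpa using h

lemma summable_pi_prod {ι : Type*} {F : ι → ℝ} (hF0 : ∀ i, 0 ≤ F i) (hF : Summable F) (n : ℕ) :
    Summable fun x : Fin n → ι => ∏ i, F (x i) := by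
  induction n with
  | zero => exact .of_finite
  | succ n ih =>
    rw [← (Fin.consEquiv (fun _ => ι)).summable_iff]
    have := hF.mul_of_nonneg ih hF0 fun x => Finset.prod_nonneg fun i _ => hF0 _
    simpa [Function.comp_def, Fin.prod_univ_succ, Fin.consEquiv] using this

end ScalarEstimates

section Weight

variable {n : ℕ} {a b : ℝ}

/-- The subexponential weight `exp (a |x| ^ b)` on `ℤⁿ`. -/
def subexpWeight (a b : ℝ) (x : Fin n → ℤ) : ℝ := Real.exp (a * (enorm' x) ^ b)

lemma one_le_subexpWeight (ha : 0 < a) (x : Fin n → ℤ) : 1 ≤ subexpWeight a b x :=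
  Real.one_le_exp (mul_nonneg ha.le (Real.rpow_nonneg (enorm'_nonneg x) _))

lemma subexpWeight_neg (x : Fin n → ℤ) : subexpWeight a b (-x) = subexpWeight a b x := by
  rw [subexpWeight, subexpWeight, enorm'_neg]

lemma subexpWeight_add_le (ha : 0 < a) (hb0 : 0 < b) (hb1 : b < 1) (x y : Fin n → ℤ) :
    subexpWeight a b (x + y) ≤ subexpWeight a b x * subexpWeight a b y := by
  rw [subexpWeight, subexpWeight, subexpWeight, ← Real.exp_add, ← mul_add]
  gcongr
  refine (Real.rpow_le_rpow (enorm'_nonneg _) (enorm'_add_le x y) hb0.le).trans ?_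
  exact Real.rpow_add_le_add_rpow (enorm'_nonneg x) (enorm'_nonneg y) hb0.le hb1.le

lemma subexpWeight_add_le_of_le (ha : 0 < a) (hb0 : 0 < b) (hb1 : b < 1) {x y : Fin n → ℤ}
    (hxy : enorm' y ≤ enorm' x) :
    subexpWeight a b (x + y) ≤ subexpWeight a b x * subexpWeight a b y ^ ((2 : ℝ) ^ b - 1) := by
  rw [subexpWeight, subexpWeight, subexpWeight, ← Real.exp_mul, ← Real.exp_add]
  refine Real.exp_le_exp.mpr ?_
  calc a * enorm' (x + y) ^ b ≤ a * (enorm' x + enorm' y) ^ b := by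
        gcongr
        · exact enorm'_nonneg _
        · exact enorm'_add_le x y
    _ ≤ a * (enorm' x ^ b + (2 ^ b - 1) * enorm' y ^ b) := by
        gcongr
        exact add_rpow_le_of_le hb0 hb1 (enorm'_nonneg y) hxy
    _ = _ := by ring

lemma subexpWeight_add_le_add (ha : 0 < a) (hb0 : 0 < b) (hb1 : b < 1) (x y : Fin n → ℤ) :
    subexpWeight a b (x + y) ≤ subexpWeight a b x * subexpWeight a b y ^ ((2 : ℝ) ^ b - 1)
      + subexpWeight a b x ^ ((2 : ℝ) ^ b - 1) * subexpWeight a b y := by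
  have hp : ∀ z : Fin n → ℤ, 0 ≤ subexpWeight a b z := fun z => (Real.exp_pos _).le
  rcases le_total (enorm' y) (enorm' x) with h | h
  · refine (subexpWeight_add_le_of_le ha hb0 hb1 h).trans (le_add_of_nonneg_right ?_)
    exact mul_nonneg (Real.rpow_nonneg (hp x) _) (hp y)
  · rw [add_comm x y, mul_comm (subexpWeight a b x ^ _)]
    refine (subexpWeight_add_le_of_le ha hb0 hb1 h).trans (le_add_of_nonneg_left ?_)
    exact mul_nonneg (hp x) (Real.rpow_nonneg (hp y) _)

lemma tendsto_subexpWeight_nsmul (hb1 : b < 1) (x : Fin n → ℤ) :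
    Tendsto (fun m : ℕ => subexpWeight a b (m • x) ^ ((m : ℝ)⁻¹)) atTop (𝓝 1) := by
  have h0 : Tendsto (fun m : ℕ => (m : ℝ) ^ (-(1 - b))) atTop (𝓝 0) :=
    (tendsto_rpow_neg_atTop (by linarith)).comp tendsto_natCast_atTop_atTop
  have h1 : Tendsto (fun m : ℕ => Real.exp (a * enorm' x ^ b * (m : ℝ) ^ (-(1 - b)))) atTop
      (𝓝 1) := by
    have := Real.continuous_exp.continuousAt.tendsto.comp (h0.const_mul (a * enorm' x ^ b))
    simpa [Function.comp_def] using this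
  refine h1.congr' ?_
  filter_upwards [eventually_gt_atTop 0] with m hm
  have hm' : (0 : ℝ) < m := by exact_mod_cast hm
  rw [subexpWeight, ← Real.exp_mul, enorm'_nsmul, Real.mul_rpow hm'.le (enorm'_nonneg x)]
  congr 1
  have : (m : ℝ) ^ (-(1 - b)) = (m : ℝ) ^ b * (m : ℝ)⁻¹ := by
    rw [← Real.rpow_neg_one, ← Real.rpow_add hm']
    congr 1; ring
  rw [this]; ring

lemma summable_subexpWeight_inv (ha : 0 < a) (hb0 : 0 < b) (hb1 : b < 1) :
    Summable fun x : Fin n → ℤ => (subexpWeight a b x)⁻¹ := by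
  obtain ⟨C, hC, h⟩ := exists_one_add_rpow_le_mul_exp ha hb0 hb1 (s := (2 * n : ℕ))
    (Nat.cast_nonneg _)
  have hs := (summable_pi_prod (fun _ => by positivity) summable_one_add_abs_int_pow_two_inv
    n).mul_left C
  refine hs.of_nonneg_of_le (fun x => inv_nonneg.mpr (Real.exp_pos _).le) fun x => ?_
  have h1 := h _ (enorm'_nonneg x)
  rw [Real.rpow_natCast] at h1
  have h2 : ∏ i, (1 + |(x i : ℝ)|) ^ 2 ≤ (1 + enorm' x) ^ (2 * n) := by
    rw [pow_mul]
    refine (Finset.prod_le_prod (fun _ _ => by positivity) fun i _ =>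
      pow_le_pow_left₀ (by positivity) (add_le_add_right (abs_apply_le_enorm' x i) 1) 2).trans ?_
    simp
  rw [subexpWeight, Finset.prod_inv_distrib, ← div_eq_mul_inv,
    inv_le_iff_one_le_mul₀ (Real.exp_pos _), div_mul_eq_mul_div,
    one_le_div (Finset.prod_pos fun _ _ => by positivity)]
  exact h2.trans h1

end Weight

section TwistedConvolution

variable {n : ℕ} {θ : Fin n → Fin n → ℂ}

lemma norm_coc (hUnit : ∀ j k, ‖θ j k‖ = 1) (l m : Fin n → ℤ) : ‖coc θ l m‖ = 1 := by
  simp [coc, hUnit]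

lemma coc_add_left (hUnit : ∀ j k, ‖θ j k‖ = 1) (l l' m : Fin n → ℤ) :
    coc θ (l + l') m = coc θ l m * coc θ l' m := by
  rw [coc, coc, coc, ← Finset.prod_mul_distrib]
  refine Finset.prod_congr rfl fun p _ => ?_
  have h : θ p.2 p.1 ≠ 0 := norm_ne_zero_iff.mp (by simp [hUnit])
  rw [← zpow_add₀ h, Pi.add_apply, add_mul]

lemma coc_add_right (hUnit : ∀ j k, ‖θ j k‖ = 1) (l m m' : Fin n → ℤ) :
    coc θ l (m + m') = coc θ l m * coc θ l m' := by
  rw [coc, coc, coc, ← Finset.prod_mul_distrib]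
  refine Finset.prod_congr rfl fun p _ => ?_
  have h : θ p.2 p.1 ≠ 0 := norm_ne_zero_iff.mp (by simp [hUnit])
  rw [← zpow_add₀ h, Pi.add_apply, mul_add]

lemma coc_zero_left (m : Fin n → ℤ) : coc θ 0 m = 1 := by simp [coc]

lemma coc_zero_right (l : Fin n → ℤ) : coc θ l 0 = 1 := by simp [coc]

lemma tconv_delta (f : (Fin n → ℤ) → ℂ) (y x : Fin n → ℤ) :
    tconv (coc θ) f (delta y) x = f (x - y) * coc θ (x - y) y := by
  rw [tconv, tsum_eq_single (x - y)]
  · simp [delta]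
  · intro z hz
    have : x - z ≠ y := fun h => hz (by rw [← h]; abel)
    simp [delta, this]

lemma delta_zero_tconv (f : (Fin n → ℤ) → ℂ) : tconv (coc θ) (delta 0) f = f := by
  ext x
  rw [tconv, tsum_eq_single 0]
  · simp [delta, coc_zero_left]
  · intro z hz
    simp [delta, hz]

lemma summable_norm_tconv (hUnit : ∀ j k, ‖θ j k‖ = 1) {f g : (Fin n → ℤ) → ℂ}
    (hf : Summable fun x => ‖f x‖) (hg : Summable fun x => ‖g x‖) :
    Summable fun x => ‖tconv (coc θ) f g x‖ := by
  let e : (Fin n → ℤ) × (Fin n → ℤ) ≃ (Fin n → ℤ) × (Fin n → ℤ) :=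
    ⟨fun p => (p.2, p.1 - p.2), fun p => (p.1 + p.2, p.1), fun p => by simp, fun p => by simp⟩
  have h := hf.mul_of_nonneg hg (fun _ => norm_nonneg _) (fun _ => norm_nonneg _)
  have h' : Summable fun p : (Fin n → ℤ) × (Fin n → ℤ) => ‖f p.2‖ * ‖g (p.1 - p.2)‖ :=
    e.summable_iff.mpr h
  refine h'.prod.of_nonneg_of_le (fun _ => norm_nonneg _) fun x => ?_
  have hs : Summable fun y => ‖f y * g (x - y) * coc θ y (x - y)‖ := by
    simpa [norm_coc hUnit] using h'.prod_factor x
  refine (norm_tsum_le_tsum_norm hs).trans_eq ?_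
  simp [norm_coc hUnit]

lemma tconv_assoc (hUnit : ∀ j k, ‖θ j k‖ = 1) {f g h : (Fin n → ℤ) → ℂ}
    (hf : Summable fun x => ‖f x‖) (hg : Summable fun x => ‖g x‖) (hh : Summable fun x => ‖h x‖) :
    tconv (coc θ) f (tconv (coc θ) g h) = tconv (coc θ) (tconv (coc θ) f g) h := by
  ext x
  let F : (Fin n → ℤ) × (Fin n → ℤ) → ℂ := fun p =>
    f p.1 * g p.2 * h (x - p.1 - p.2) * (coc θ p.2 (x - p.1 - p.2) * coc θ p.1 (x - p.1))
  have hF : Summable F := by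
    have h1 := (hf.mul_of_nonneg hg (fun _ => norm_nonneg _) (fun _ => norm_nonneg _)).mul_right
      (∑' y, ‖h y‖)
    refine h1.of_norm_bounded fun p => ?_
    simp only [F, norm_mul, norm_coc hUnit, mul_one]
    gcongr
    exact hh.le_tsum _ fun _ _ => norm_nonneg _
  let e : (Fin n → ℤ) × (Fin n → ℤ) ≃ (Fin n → ℤ) × (Fin n → ℤ) :=
    ⟨fun p => (p.2, p.1 - p.2), fun p => (p.1 + p.2, p.1), fun p => by simp, fun p => by simp⟩
  have hFe : Summable (F ∘ e) := e.summable_iff.mpr hF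
  calc tconv (coc θ) f (tconv (coc θ) g h) x = ∑' y, ∑' z, F (y, z) := by
        refine tsum_congr fun y => ?_
        simp only [tconv]
        rw [← tsum_mul_left, ← tsum_mul_right]
        exact tsum_congr fun z => by simp only [F]; ring
    _ = ∑' p, F p := hF.tsum_prod.symm
    _ = ∑' p, (F ∘ e) p := (e.tsum_eq F).symm
    _ = ∑' y, ∑' z, (F ∘ e) (y, z) := hFe.tsum_prod
    _ = tconv (coc θ) (tconv (coc θ) f g) h x := by
        refine tsum_congr fun y => ?_
        simp only [tconv]
        rw [← tsum_mul_right, ← tsum_mul_right]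
        refine tsum_congr fun z => ?_
        have e1 : x - z - (y - z) = x - y := by abel
        have e2 : coc θ z (x - z) = coc θ z (y - z) * coc θ z (x - y) := by
          rw [← coc_add_right hUnit]; congr 1; abel
        have e3 : coc θ y (x - y) = coc θ z (x - y) * coc θ (y - z) (x - y) := by
          rw [← coc_add_left hUnit]; congr 1; abel
        simp only [F, e, Function.comp_apply, Equiv.coe_fn_mk, e1, e2, e3]
        ring

lemma coe_basisVec (y : Fin n → ℤ) :
    (OffDiagonal.basisVec y : (Fin n → ℤ) → ℂ) = delta y := by
  ext x
  rw [OffDiagonal.basisVec, lp.single_apply, delta]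
  split_ifs with h <;> simp [h]

/-- If twisted convolution by `f ∈ ℓ¹` is inverted by `T.symm` and `T.symm δ₀` is in `ℓ¹`, then
`T.symm δ₀` is a two-sided inverse of `f`. -/
lemma tconv_symm_delta (hUnit : ∀ j k, ‖θ j k‖ = 1) {f : (Fin n → ℤ) → ℂ}
    (hf : Summable fun x => ‖f x‖) (T : Ltwo n ≃L[ℂ] Ltwo n)
    (hT : ∀ (h : Ltwo n) (x : Fin n → ℤ), (T h : (Fin n → ℤ) → ℂ) x = tconv (coc θ) f (⇑h) x)
    (hg : Summable fun x => ‖T.symm (OffDiagonal.basisVec 0) x‖) :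
    tconv (coc θ) f (T.symm (OffDiagonal.basisVec 0)) = delta 0 ∧
      tconv (coc θ) (T.symm (OffDiagonal.basisVec 0)) f = delta 0 := by
  set g : Ltwo n := T.symm (OffDiagonal.basisVec 0) with hgdef
  have hT' : ∀ h : Ltwo n, (T h : (Fin n → ℤ) → ℂ) = tconv (coc θ) f h := fun h => funext (hT h)
  have hfg : tconv (coc θ) f g = delta 0 := by
    rw [← hT', hgdef, T.apply_symm_apply, coe_basisVec]
  refine ⟨hfg, ?_⟩
  have hk1 := summable_norm_tconv hUnit hg hf
  have hk : Memℓp (tconv (coc θ) g f) 2 :=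
    Memℓp.of_exponent_ge (p := 2) (q := 1) (memℓp_gen (by simpa using hk1)) (by norm_num)
  have hTk : T ⟨_, hk⟩ = T (OffDiagonal.basisVec 0) := by
    apply lp.ext
    rw [hT', hT', coe_basisVec]
    calc tconv (coc θ) f (tconv (coc θ) g f) = tconv (coc θ) (delta 0) f := by
          rw [tconv_assoc hUnit hf hg hf, hfg]
      _ = tconv (coc θ) f (delta 0) := by
          ext x
          rw [delta_zero_tconv, tconv_delta, sub_zero, coc_zero_right, mul_one]
  have := congrArg (fun u : Ltwo n => (u : (Fin n → ℤ) → ℂ)) (T.injective hTk)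
  rwa [coe_basisVec] at this

lemma diagSup_tconv_le (hUnit : ∀ j k, ‖θ j k‖ = 1) {f : (Fin n → ℤ) → ℂ}
    (T : OffDiagonal.Op (Fin n → ℤ))
    (hT : ∀ (h : Ltwo n) (x : Fin n → ℤ), (T h : (Fin n → ℤ) → ℂ) x = tconv (coc θ) f (⇑h) x)
    (z : Fin n → ℤ) : OffDiagonal.diagSup T z ≤ ‖f z‖ₑ := by
  refine iSup_le fun x => ?_
  rw [hT, coe_basisVec, tconv_delta, add_sub_cancel_left, enorm_mul]
  have : ‖coc θ z x‖ₑ = 1 := by rw [← ofReal_norm, norm_coc hUnit, ENNReal.ofReal_one]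
  rw [this, mul_one]

lemma summable_symm_basisVec_mul_subexpWeight (hUnit : ∀ j k, ‖θ j k‖ = 1) {a b : ℝ} (ha : 0 < a)
    (hb0 : 0 < b) (hb1 : b < 1) {f : (Fin n → ℤ) → ℂ}
    (hf : Summable fun x => ‖f x‖ * subexpWeight a b x) (T : Ltwo n ≃L[ℂ] Ltwo n)
    (hT : ∀ (h : Ltwo n) (x : Fin n → ℤ), (T h : (Fin n → ℤ) → ℂ) x = tconv (coc θ) f (⇑h) x) :
    Summable fun x => ‖T.symm (OffDiagonal.basisVec 0) x‖ * subexpWeight a b x := by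
  set v : (Fin n → ℤ) → ℝ := subexpWeight a b with hv
  have hpos : ∀ x, 0 < v x := fun x => Real.exp_pos _
  set w : (Fin n → ℤ) → ENNReal := fun x => ENNReal.ofReal (v x) with hw
  have hof : ∀ h : (Fin n → ℤ) → ℂ, ∀ x,
      ‖h x‖ₑ * w x = ENNReal.ofReal (‖h x‖ * v x) := fun h x => by
    rw [ENNReal.ofReal_mul (norm_nonneg _), ofReal_norm]
  have hTt : OffDiagonal.diagNorm w (T : OffDiagonal.Op (Fin n → ℤ)) ≠ ⊤ := by
    refine ne_top_of_le_ne_top hf.tsum_ofReal_ne_top (ENNReal.tsum_le_tsum fun z => ?_)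
    rw [← hof]
    gcongr
    exact diagSup_tconv_le hUnit _ hT z
  set γ : ℝ := 1 - 2 ^ b / 2 with hγ
  have hγ2 : 1 - 2 * γ = 2 ^ b - 1 := by rw [hγ]; ring
  have hlo : (1 : ℝ) < 2 ^ b := Real.one_lt_rpow one_lt_two hb0
  have hhi : (2 : ℝ) ^ b < 2 := by
    simpa using Real.rpow_lt_rpow_of_exponent_lt one_lt_two hb1
  have hsymm := OffDiagonal.diagNorm_symm_ne_top (w := w) (γ := γ)
    (fun x => by simpa [hw] using hpos x) (fun x => ENNReal.ofReal_ne_top)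
    (by rw [hγ]; linarith) (by rw [hγ]; linarith)
    (fun x => by simp only [hw, hv, subexpWeight_neg])
    (fun x y => by
      simp only [hw]
      rw [← ENNReal.ofReal_mul (hpos x).le]
      exact ENNReal.ofReal_le_ofReal (subexpWeight_add_le ha hb0 hb1 x y))
    (fun x y => by
      simp only [hw]
      rw [ENNReal.ofReal_rpow_of_pos (hpos x), ENNReal.ofReal_rpow_of_pos (hpos y),
        ← ENNReal.ofReal_mul (hpos x).le, ← ENNReal.ofReal_mul (Real.rpow_nonneg (hpos x).le _),
        ← ENNReal.ofReal_add (mul_nonneg (hpos x).le (Real.rpow_nonneg (hpos y).le _))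
          (mul_nonneg (Real.rpow_nonneg (hpos x).le _) (hpos y).le), hγ2]
      exact ENNReal.ofReal_le_ofReal (subexpWeight_add_le_add ha hb0 hb1 x y))
    (by
      simp only [hw]
      simp_rw [← ENNReal.ofReal_inv_of_pos (hpos _)]
      exact (summable_subexpWeight_inv ha hb0 hb1).tsum_ofReal_ne_top)
    T hTt
  have hfin : ∑' x, ENNReal.ofReal (‖T.symm (OffDiagonal.basisVec 0) x‖ * v x) ≠ ⊤ := by
    refine ne_top_of_le_ne_top hsymm (ENNReal.tsum_le_tsum fun z => ?_)
    rw [← hof]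
    gcongr
    simpa using OffDiagonal.enorm_entry_le_diagSup (T.symm : OffDiagonal.Op (Fin n → ℤ)) 0 z
  refine (ENNReal.summable_toReal hfin).congr fun x => ?_
  rw [ENNReal.toReal_ofReal (mul_nonneg (norm_nonneg _) (hpos x).le)]

end TwistedConvolution

/-- for a > 0, 0 < b < 1, the subexponential weight v(x) = exp(a|x|^b)
is a symmetric submultiplicative weight satisfying the GRS-condition, ℓ¹_v(ℤⁿ) consists
of rapidly decreasing sequences, and ℓ¹_v(ℤⁿ, θ) is inverse-closed in C*(θ). -/
theorem statement17 {n : ℕ} (θ : Fin n → Fin n → ℂ)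
    (hUnit : ∀ j k, ‖θ j k‖ = 1)
    (hHerm : ∀ j k, θ k j = starRingEnd ℂ (θ j k))
    (hDiag : ∀ j, θ j j = 1)
    (a b : ℝ) (ha : 0 < a) (hb0 : 0 < b) (hb1 : b < 1)
    (v : (Fin n → ℤ) → ℝ)
    (hv : ∀ x, v x = Real.exp (a * (enorm' x) ^ b)) :
    -- (a) v is a symmetric submultiplicative weight
    ((∀ x, 1 ≤ v x) ∧ (∀ x y, v (x + y) ≤ v x * v y) ∧ (∀ x, v (-x) = v x)) ∧
    -- (b) v satisfies the GRS-condition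
    (∀ x : Fin n → ℤ,
        Filter.Tendsto (fun m : ℕ => (v (m • x)) ^ ((m : ℝ)⁻¹)) atTop (𝓝 1)) ∧
    -- (c) every f ∈ ℓ¹_v is rapidly decreasing
    (∀ f : (Fin n → ℤ) → ℂ, Summable (fun x => ‖f x‖ * v x) →
        ∀ s : ℝ, 0 ≤ s → ∃ C : ℝ, ∀ x : Fin n → ℤ, ‖f x‖ * (1 + enorm' x) ^ s ≤ C) ∧
    -- (d) ℓ¹_v(ℤⁿ, θ) is inverse-closed in C*(θ)
    (∀ f : (Fin n → ℤ) → ℂ, Summable (fun x => ‖f x‖ * v x) →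
        ∀ T : Ltwo n ≃L[ℂ] Ltwo n,
          (∀ (h : Ltwo n) (x : Fin n → ℤ),
            (T h : (Fin n → ℤ) → ℂ) x = tconv (coc θ) f (⇑h) x) →
          ∃ g : (Fin n → ℤ) → ℂ, Summable (fun x => ‖g x‖ * v x) ∧
            tconv (coc θ) f g = delta 0 ∧ tconv (coc θ) g f = delta 0) := by
  obtain rfl : v = subexpWeight a b := funext hv
  refine ⟨⟨one_le_subexpWeight ha, subexpWeight_add_le ha hb0 hb1, subexpWeight_neg⟩,
    tendsto_subexpWeight_nsmul hb1, fun f hf s hs => ?_, fun f hf T hT => ?_⟩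
  · obtain ⟨C, hC, h⟩ := exists_one_add_rpow_le_mul_exp ha hb0 hb1 hs
    refine ⟨C * ∑' y, ‖f y‖ * subexpWeight a b y, fun x => ?_⟩
    have hx := hf.le_tsum x fun y _ => mul_nonneg (norm_nonneg _) (Real.exp_pos _).le
    calc ‖f x‖ * (1 + enorm' x) ^ s
        ≤ ‖f x‖ * (C * subexpWeight a b x) := by
          gcongr
          exact h _ (enorm'_nonneg x)
      _ = C * (‖f x‖ * subexpWeight a b x) := by ring
      _ ≤ _ := by gcongr
  · have summable_norm : ∀ {h : (Fin n → ℤ) → ℂ},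
        Summable (fun x => ‖h x‖ * subexpWeight a b x) → Summable fun x => ‖h x‖ := fun hh =>
      hh.of_nonneg_of_le (fun _ => norm_nonneg _) fun x =>
        le_mul_of_one_le_right (norm_nonneg _) (one_le_subexpWeight ha x)
    have hg := summable_symm_basisVec_mul_subexpWeight hUnit ha hb0 hb1 hf T hT
    exact ⟨_, hg, tconv_symm_delta hUnit (summable_norm hf) T hT (summable_norm hg)⟩
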